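/- arXiv:2306.09104 — 3 statements merged into one kernel-verified Lean document; each statement's English description precedes it below -/
import Mathlib

section
/- (Fano's inequality, as stated in the paper.) Let X and Y be random variables on a common probability space taking values in finite sets 𝒳 and 𝒴 respectively, let f : 𝒴 → 𝒳 be any function, set X̂ = f(Y), and let e = ℙ(X ≠ X̂). Then the conditional entropy satisfies H(X | Y) ≤ H_b(e) + e · log(|𝒳| + 1). -/
open MeasureTheory Real

/-- Shannon entropy of a finite-valued random variable (natural logarithm). -/
noncomputable def entropy {Ω : Type*} [MeasurableSpace Ω] (μ : Measure Ω)
    {S : Type*} [Fintype S] (X : Ω → S) : ℝ :=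
  ∑ x : S, Real.negMulLog (μ (X ⁻¹' {x})).toReal

/-- Conditional entropy `H(X | Y) = H(X, Y) - H(Y)`. -/
noncomputable def condEntropy {Ω : Type*} [MeasurableSpace Ω] (μ : Measure Ω)
    {S T : Type*} [Fintype S] [Fintype T] (X : Ω → S) (Y : Ω → T) : ℝ :=
  entropy μ (fun ω => (X ω, Y ω)) - entropy μ Y

/-- Binary entropy `H_b(p) = −p log p − (1−p) log(1−p)`. -/
noncomputable def binEnt (p : ℝ) : ℝ :=
  Real.negMulLog p + Real.negMulLog (1 - p)

/-- The Gibbs inequality for a finite nonnegative family `p`, against subprobability weights `r`. -/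
lemma sum_negMulLog_le_of_sum_le_one {ι : Type*} [Fintype ι] {p r : ι → ℝ}
    (hp : ∀ i, 0 ≤ p i) (hr : ∀ i, 0 ≤ r i) (hr_sum : ∑ i, r i ≤ 1)
    (hpr : ∀ i, r i = 0 → p i = 0) :
    ∑ i, negMulLog (p i) ≤ negMulLog (∑ i, p i) - ∑ i, p i * log (r i) := by
  set q := ∑ i, p i with hq
  have hq0 : 0 ≤ q := Finset.sum_nonneg fun i _ => hp i
  have pointwise (i : ι) :
      negMulLog (p i) ≤ -(p i * log q) - p i * log (r i) + (q * r i - p i) := by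
    rcases (hp i).eq_or_lt with h | h
    · simpa [← h] using mul_nonneg hq0 (hr i)
    · have hqi : 0 < q := h.trans_le (Finset.single_le_sum (fun j _ => hp j) (Finset.mem_univ i))
      have hri : 0 < r i := (hr i).lt_of_ne fun h0 => h.ne' (hpr i h0.symm)
      have key := mul_le_mul_of_nonneg_left
        (log_le_sub_one_of_pos (div_pos (mul_pos hqi hri) h)) h.le
      rw [log_div (mul_pos hqi hri).ne' h.ne', log_mul hqi.ne' hri.ne', mul_sub_one,
        mul_div_cancel₀ _ h.ne'] at key
      rw [negMulLog]
      linarith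
  calc ∑ i, negMulLog (p i)
      ≤ ∑ i, (-(p i * log q) - p i * log (r i) + (q * r i - p i)) :=
        Finset.sum_le_sum fun i _ => pointwise i
    _ = negMulLog q - ∑ i, p i * log (r i) + (q * ∑ i, r i - q) := by
        rw [Finset.sum_add_distrib, Finset.sum_sub_distrib, Finset.sum_sub_distrib,
          Finset.sum_neg_distrib, ← Finset.sum_mul, ← Finset.mul_sum, ← hq, negMulLog]
        ring
    _ ≤ negMulLog q - ∑ i, p i * log (r i) := by
        linarith [mul_le_of_le_one_right hq0 hr_sum]

/-- Fano's inequality for a joint probability mass function `p` and a guess `f` that is correct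
with probability `1 - e`. -/
lemma fano_inequality_of_pmf {S T : Type*} [Fintype S] [Fintype T] {p : S → T → ℝ}
    (hp : ∀ x y, 0 ≤ p x y) (hp_sum : ∑ y, ∑ x, p x y = 1) (f : T → S) {e : ℝ}
    (he : ∑ y, p (f y) y = 1 - e) :
    ∑ y, ∑ x, negMulLog (p x y) ≤
      ∑ y, negMulLog (∑ x, p x y) + (binEnt e + e * log (Fintype.card S + 1)) := by
  classical
  set N : ℝ := (Fintype.card S : ℝ) with hN
  have hN0 : 0 ≤ N := Nat.cast_nonneg _
  set b : T → ℝ := fun y => ∑ x ∈ Finset.univ.erase (f y), p x y with hb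
  have hsplit (y : T) (g : S → ℝ) :
      ∑ x, g x = g (f y) + ∑ x ∈ Finset.univ.erase (f y), g x :=
    (Finset.add_sum_erase _ _ (Finset.mem_univ _)).symm
  have hb0 (y : T) : 0 ≤ b y := Finset.sum_nonneg fun x _ => hp x y
  have hb_sum : ∑ y, b y = e := by
    have : ∑ y, ∑ x, p x y = ∑ y, p (f y) y + ∑ y, b y := by
      rw [← Finset.sum_add_distrib]
      exact Finset.sum_congr rfl fun y _ => hsplit y fun x => p x y
    linarith
  have he0 : 0 ≤ e := hb_sum ▸ Finset.sum_nonneg fun y _ => hb0 y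
  have he1 : 0 ≤ 1 - e := he ▸ Finset.sum_nonneg fun y _ => hp (f y) y
  set r : T → S → ℝ := fun y x => if x = f y then 1 - e else e / (N + 1) with hr
  have hr_ne {y : T} {x : S} (hx : x ∈ Finset.univ.erase (f y)) : r y x = e / (N + 1) :=
    if_neg (Finset.ne_of_mem_erase hx)
  have hr0 (y : T) (x : S) : 0 ≤ r y x := by
    simp only [hr]
    split_ifs <;> positivity
  have hr_sum (y : T) : ∑ x, r y x ≤ 1 := by
    rw [hsplit y, Finset.sum_congr rfl fun x hx => hr_ne hx, Finset.sum_const, nsmul_eq_mul]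
    have hcard : ((Finset.univ.erase (f y)).card : ℝ) ≤ N + 1 := by
      have : (Finset.univ.erase (f y)).card ≤ Fintype.card S := Finset.card_le_univ _
      have : ((Finset.univ.erase (f y)).card : ℝ) ≤ N := Nat.cast_le.2 this
      linarith
    have h := mul_le_mul_of_nonneg_right hcard (show 0 ≤ e / (N + 1) by positivity)
    rw [mul_div_cancel₀ e (by positivity)] at h
    simp only [hr, if_true]
    linarith
  have hpr (y : T) (x : S) (h : r y x = 0) : p x y = 0 := by
    by_cases hx : x = f y
    · subst hx
      rw [show r y (f y) = 1 - e from if_pos rfl, ← he,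
        Finset.sum_eq_zero_iff_of_nonneg fun y _ => hp (f y) y] at h
      exact h y (Finset.mem_univ y)
    · have hmem : x ∈ Finset.univ.erase (f y) := by simp [hx]
      rw [hr_ne hmem, div_eq_zero_iff, or_iff_left (by positivity), ← hb_sum,
        Finset.sum_eq_zero_iff_of_nonneg fun y _ => hb0 y] at h
      exact (Finset.sum_eq_zero_iff_of_nonneg fun x _ => hp x y).1
        (h y (Finset.mem_univ y)) x hmem
  have hlog (y : T) :
      ∑ x, p x y * log (r y x) = p (f y) y * log (1 - e) + b y * log (e / (N + 1)) := by
    rw [hsplit y, Finset.sum_congr rfl fun x hx => by rw [hr_ne hx], ← Finset.sum_mul]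
    simp [hr, hb]
  have hcross : ∑ y, ∑ x, p x y * log (r y x) = -(binEnt e + e * log (N + 1)) := by
    simp_rw [hlog]
    rw [Finset.sum_add_distrib, ← Finset.sum_mul, ← Finset.sum_mul, he, hb_sum, binEnt,
      negMulLog, negMulLog]
    rcases he0.eq_or_lt with h | h
    · simp [← h]
    · rw [log_div h.ne' (by positivity)]
      ring
  calc ∑ y, ∑ x, negMulLog (p x y)
      ≤ ∑ y, (negMulLog (∑ x, p x y) - ∑ x, p x y * log (r y x)) :=
        Finset.sum_le_sum fun y _ =>
          sum_negMulLog_le_of_sum_le_one (fun x => hp x y) (hr0 y) (hr_sum y) (hpr y)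
    _ = _ := by rw [Finset.sum_sub_distrib, hcross, sub_neg_eq_add]

/-- A finite-valued random variable partitions every event. -/
lemma sum_measureReal_inter_preimage_singleton {Ω T : Type*} [MeasurableSpace Ω]
    (μ : Measure Ω) [IsFiniteMeasure μ] [Fintype T] [MeasurableSpace T]
    [MeasurableSingletonClass T] {Y : Ω → T} (hY : Measurable Y) (A : Set Ω) :
    ∑ y, μ.real (A ∩ Y ⁻¹' {y}) = μ.real A := by
  have h := sum_measureReal_preimage_singleton (μ := μ.restrict A) (f := Y) Finset.univ
    fun y _ => hY (measurableSet_singleton y)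
  simpa [measureReal_restrict_apply (hY (measurableSet_singleton _)), Set.inter_comm] using h

/-- Fano's inequality (as stated in the paper): with `X̂ = f ∘ Y` and
`e = ℙ(X ≠ X̂)`, we have `H(X | Y) ≤ H_b(e) + e · log(|𝒳| + 1)`. -/
theorem fano_inequality
    {Ω : Type*} [MeasurableSpace Ω] (μ : Measure Ω) [IsProbabilityMeasure μ]
    {𝒳 𝒴 : Type*}
    [Fintype 𝒳] [Nonempty 𝒳] [MeasurableSpace 𝒳] [MeasurableSingletonClass 𝒳]
    [Fintype 𝒴] [Nonempty 𝒴] [MeasurableSpace 𝒴] [MeasurableSingletonClass 𝒴]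
    (X : Ω → 𝒳) (Y : Ω → 𝒴) (hX : Measurable X) (hY : Measurable Y)
    (f : 𝒴 → 𝒳) (e : ℝ)
    (he : e = (μ {ω | X ω ≠ f (Y ω)}).toReal) :
    condEntropy μ X Y ≤ binEnt e + e * Real.log (Fintype.card 𝒳 + 1) := by
  set p : 𝒳 → 𝒴 → ℝ := fun x y => μ.real (X ⁻¹' {x} ∩ Y ⁻¹' {y}) with hp
  have hmarginal (y : 𝒴) : ∑ x, p x y = μ.real (Y ⁻¹' {y}) := by
    simp_rw [hp, Set.inter_comm (X ⁻¹' _)]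
    exact sum_measureReal_inter_preimage_singleton μ hX _
  have hp_sum : ∑ y, ∑ x, p x y = 1 := by
    simpa [hmarginal] using sum_measureReal_inter_preimage_singleton μ hY Set.univ
  have hcorrect : ∑ y, p (f y) y = 1 - e := by
    have hmeas : MeasurableSet {ω | X ω = f (Y ω)} :=
      measurableSet_eq_fun hX ((measurable_of_finite f).comp hY)
    have hcompl : e = 1 - μ.real {ω | X ω = f (Y ω)} := by
      rw [he, ← probReal_compl_eq_one_sub hmeas]
      rfl
    rw [hcompl, sub_sub_cancel, ← sum_measureReal_inter_preimage_singleton μ hY]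
    refine Finset.sum_congr rfl fun y _ => congrArg μ.real ?_
    ext ω
    simp +contextual
  have hjoint : entropy μ (fun ω => (X ω, Y ω)) = ∑ y, ∑ x, negMulLog (p x y) := by
    rw [entropy, Fintype.sum_prod_type_right]
    refine Finset.sum_congr rfl fun y _ => Finset.sum_congr rfl fun x _ => ?_
    rw [← Set.singleton_prod_singleton, Set.mk_preimage_prod]
    rfl
  have hfano := fano_inequality_of_pmf (p := p) (fun x y => measureReal_nonneg) hp_sum f hcorrect
  rw [← hjoint] at hfano
  simp_rw [hmarginal] at hfano
  exact sub_le_iff_le_add'.2 hfano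
end

section
/- (Fano converse on the error probability.) Let X and Y be random variables on a common probability space taking values in finite sets 𝒳 and 𝒴 respectively with |𝒳| ≥ 2, let f : 𝒴 → 𝒳 be any function, set X̂ = f(Y), and let e = ℙ(X ≠ X̂). Then e ≥ (H(X | Y) − log 2) / log |𝒳|. -/
open MeasureTheory Real

/-- Gibbs' inequality, pointwise. -/
lemma negMulLog_le_neg_mul_log_add_sub {p q : ℝ} (hp : 0 ≤ p) (hq : 0 < q) :
    negMulLog p ≤ -p * log q + (q - p) := by
  rcases hp.eq_or_lt with rfl | hp
  · simpa using hq.le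
  · have h := mul_le_mul_of_nonneg_left (log_le_sub_one_of_pos (div_pos hq hp)) hp.le
    rw [log_div hq.ne' hp.ne', mul_sub, mul_sub, mul_div_cancel₀ q hp.ne'] at h
    rw [negMulLog]
    linarith

/-- Fano's inequality for an unnormalized finite distribution `a` and a guess `c`. -/
lemma sum_negMulLog_le_of_guess {S : Type*} [Fintype S] {a : S → ℝ} (ha : ∀ x, 0 ≤ a x) (c : S) :
    ∑ x, negMulLog (a x) ≤ negMulLog (∑ x, a x) + (∑ x, a x) * log 2
      + (∑ x, a x - a c) * log (Fintype.card S) := by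
  classical
  have hM : (0 : ℝ) < Fintype.card S := by exact_mod_cast Fintype.card_pos_iff.mpr ⟨c⟩
  set P := ∑ x, a x with hP
  have hP0 : 0 ≤ P := Finset.sum_nonneg fun x _ => ha x
  rcases hP0.eq_or_lt with h0 | hpos
  · have ha0 : ∀ x, a x = 0 := fun x =>
      (Finset.sum_eq_zero_iff_of_nonneg fun x _ => ha x).mp (hP.symm.trans h0.symm) x
        (Finset.mem_univ x)
    simp [ha0, ← h0]
  · have hsplit : ∀ g : S → ℝ, ∑ x, g x = g c + ∑ x ∈ Finset.univ.erase c, g x := fun g =>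
      (Finset.add_sum_erase _ g (Finset.mem_univ c)).symm
    have hc : negMulLog (a c) ≤ -a c * log (P / 2) + (P / 2 - a c) :=
      negMulLog_le_neg_mul_log_add_sub (ha c) (by positivity)
    have hne : ∑ x ∈ Finset.univ.erase c, negMulLog (a x) ≤
        ∑ x ∈ Finset.univ.erase c, (-a x * log (P / 2 / Fintype.card S)
          + (P / 2 / Fintype.card S - a x)) :=
      Finset.sum_le_sum fun x _ => negMulLog_le_neg_mul_log_add_sub (ha x) (by positivity)
    have hrest : ∑ x ∈ Finset.univ.erase c, a x = P - a c := by rw [hP, hsplit]; ring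
    have hmass : ((Finset.univ.erase c).card : ℝ) * (P / 2 / Fintype.card S) ≤ P / 2 := by
      rw [mul_div_assoc', div_le_iff₀ hM, mul_comm]
      gcongr
      exact Finset.card_le_univ _
    rw [Finset.sum_add_distrib, ← Finset.sum_mul, Finset.sum_neg_distrib,
      Finset.sum_sub_distrib, hrest, Finset.sum_const, nsmul_eq_mul,
      log_div (by positivity) hM.ne', log_div hpos.ne' two_ne_zero] at hne
    rw [log_div hpos.ne' two_ne_zero] at hc
    have hPlog : negMulLog P = -P * log P := rfl
    rw [hsplit, hPlog]
    linarith

/-- The fibres of a finite-valued random variable partition every event. -/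
lemma sum_measureReal_inter_fiber {Ω S : Type*} [MeasurableSpace Ω] (μ : Measure Ω)
    [IsFiniteMeasure μ] [Fintype S] [MeasurableSpace S] [MeasurableSingletonClass S]
    {X : Ω → S} (hX : Measurable X) (A : Set Ω) :
    ∑ x, μ.real (X ⁻¹' {x} ∩ A) = μ.real A := by
  have hm : ∀ x, MeasurableSet (X ⁻¹' {x}) := fun x => hX (measurableSet_singleton x)
  have h := sum_measureReal_preimage_singleton (μ := μ.restrict A) Finset.univ
    (f := X) (fun x _ => hm x)
  simpa [measureReal_restrict_apply (hm _)] using h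

/-- Fano converse on the error probability: with `X̂ = f ∘ Y`,
`e = ℙ(X ≠ X̂)` and `|𝒳| ≥ 2`, we have `e ≥ (H(X | Y) − log 2) / log |𝒳|`. -/
theorem fano_converse
    {Ω : Type*} [MeasurableSpace Ω] (μ : Measure Ω) [IsProbabilityMeasure μ]
    {𝒳 𝒴 : Type*}
    [Fintype 𝒳] [Nonempty 𝒳] [MeasurableSpace 𝒳] [MeasurableSingletonClass 𝒳]
    [Fintype 𝒴] [Nonempty 𝒴] [MeasurableSpace 𝒴] [MeasurableSingletonClass 𝒴]
    (hcard : 2 ≤ Fintype.card 𝒳)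
    (X : Ω → 𝒳) (Y : Ω → 𝒴) (hX : Measurable X) (hY : Measurable Y)
    (f : 𝒴 → 𝒳) (e : ℝ)
    (he : e = (μ {ω | X ω ≠ f (Y ω)}).toReal) :
    e ≥ (condEntropy μ X Y - Real.log 2) / Real.log (Fintype.card 𝒳) := by
  have hM : 0 < Real.log (Fintype.card 𝒳) := Real.log_pos (by exact_mod_cast hcard)
  have hmarg : ∀ y, ∑ x, μ.real (X ⁻¹' {x} ∩ Y ⁻¹' {y}) = μ.real (Y ⁻¹' {y}) :=
    fun y => sum_measureReal_inter_fiber μ hX _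
  have htotal : ∑ y, μ.real (Y ⁻¹' {y}) = 1 := by
    simpa using sum_measureReal_inter_fiber μ hY Set.univ
  have herr : e = ∑ y, (μ.real (Y ⁻¹' {y}) - μ.real (X ⁻¹' {f y} ∩ Y ⁻¹' {y})) := by
    rw [he, ← measureReal_def, ← sum_measureReal_inter_fiber μ hY]
    refine Finset.sum_congr rfl fun y _ => ?_
    rw [Set.inter_comm (X ⁻¹' {f y}), eq_sub_iff_add_eq',
      ← measureReal_inter_add_sdiff (s := Y ⁻¹' {y}) (hX (measurableSet_singleton (f y)))]
    congr 2
    ext ω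
    simp only [Set.mem_inter_iff, Set.mem_sdiff, Set.mem_preimage, Set.mem_singleton_iff,
      Set.mem_ofPred_eq]
    exact and_congr_right fun h => by rw [h]
  have hjoint : entropy μ (fun ω => (X ω, Y ω)) =
      ∑ y, ∑ x, negMulLog (μ.real (X ⁻¹' {x} ∩ Y ⁻¹' {y})) := by
    rw [entropy, Fintype.sum_prod_type_right]
    simp only [← Set.singleton_prod_singleton, Set.mk_preimage_prod, measureReal_def]
  have hfano := Finset.sum_le_sum fun y (_ : y ∈ Finset.univ) =>
    sum_negMulLog_le_of_guess (fun x => measureReal_nonneg (μ := μ) (s := X ⁻¹' {x} ∩ Y ⁻¹' {y}))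
      (f y)
  simp only [hmarg, Finset.sum_add_distrib, ← Finset.sum_mul] at hfano
  rw [← hjoint, ← herr, htotal] at hfano
  rw [ge_iff_le, div_le_iff₀ hM, condEntropy, entropy.eq_def μ Y]
  simp only [measureReal_def] at hfano
  linarith
end

section
/- (Information bottleneck Lagrangian bound and optimality condition.) Let Y, A, Z be finite-valued random variables on a common probability space forming a Markov chain Y → A → Z (i.e., Y and Z are conditionally independent given A), and let β ∈ [0, 1]. Then I(Z; Y) − β · I(Z; A) ≤ (1 − β) · I(A; Y). Moreover, if 0 < β < 1, equality holds if and only if I(A; Y | Z) = 0 and I(Z; A | Y) = 0. -/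
open MeasureTheory Real

/-- Mutual information `I(X; Y) = H(X) + H(Y) - H(X, Y)`. -/
noncomputable def mutualInfo {Ω : Type*} [MeasurableSpace Ω] (μ : Measure Ω)
    {S T : Type*} [Fintype S] [Fintype T] (X : Ω → S) (Y : Ω → T) : ℝ :=
  entropy μ X + entropy μ Y - entropy μ (fun ω => (X ω, Y ω))

/-- Conditional mutual information `I(X; Y | Z) = H(X|Z) + H(Y|Z) - H((X,Y)|Z)`. -/
noncomputable def condMutualInfo {Ω : Type*} [MeasurableSpace Ω] (μ : Measure Ω)
    {S T U : Type*} [Fintype S] [Fintype T] [Fintype U]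
    (X : Ω → S) (Y : Ω → T) (Z : Ω → U) : ℝ :=
  condEntropy μ X Z + condEntropy μ Y Z - condEntropy μ (fun ω => (X ω, Y ω)) Z


/-- Shannon entropy is invariant under relabelling of the values. -/
lemma entropy_equiv_comp {Ω : Type*} [MeasurableSpace Ω] (μ : Measure Ω)
    {S T : Type*} [Fintype S] [Fintype T] (e : S ≃ T) (X : Ω → S) :
    entropy μ (fun ω => e (X ω)) = entropy μ X := by
  unfold entropy
  refine (Fintype.sum_equiv e _ _ fun x => ?_).symm
  congr 3
  ext ω
  simp

/-- A measure is recovered by summing over the values of a finite-valued random variable. -/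
lemma measureReal_eq_sum_inter_preimage {Ω : Type*} [MeasurableSpace Ω] (μ : Measure Ω)
    [IsFiniteMeasure μ] {T : Type*} [Fintype T] [MeasurableSpace T] [MeasurableSingletonClass T]
    {Y : Ω → T} (hY : Measurable Y) (E : Set Ω) :
    μ.real E = ∑ y, μ.real (E ∩ Y ⁻¹' {y}) := by
  have hm : ∀ y, MeasurableSet (Y ⁻¹' {y}) := fun y => hY (measurableSet_singleton y)
  have h := sum_measure_preimage_singleton (μ := μ.restrict E) (f := Y) Finset.univ
    fun y _ => hm y
  simp only [Finset.coe_univ, Set.preimage_univ, Measure.restrict_apply_univ] at h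
  simp only [Measure.real]
  rw [← h, ENNReal.toReal_sum fun y _ => measure_ne_top _ _]
  refine Finset.sum_congr rfl fun y _ => ?_
  rw [Measure.restrict_apply (hm y), Set.inter_comm]

/-- The entropy defect of a matrix against its marginals, as a relative-entropy sum. -/
lemma sum_negMulLog_marginals {S T : Type*} [Fintype S] [Fintype T] (m : S → T → ℝ) :
    ∑ x, negMulLog (∑ y, m x y) + ∑ y, negMulLog (∑ x, m x y)
        - negMulLog (∑ x, ∑ y, m x y) - ∑ x, ∑ y, negMulLog (m x y)
      = ∑ x, ∑ y, m x y * (log (m x y) + log (∑ x', ∑ y', m x' y')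
          - log (∑ y', m x y') - log (∑ x', m x' y)) := by
  have hcol : ∑ y, negMulLog (∑ x, m x y) = -∑ x, ∑ y, m x y * log (∑ x', m x' y) := by
    rw [Finset.sum_comm, ← Finset.sum_neg_distrib]
    exact Finset.sum_congr rfl fun y _ => by rw [negMulLog, ← Finset.sum_mul, neg_mul]
  have hrow : ∑ x, negMulLog (∑ y, m x y) = -∑ x, ∑ y, m x y * log (∑ y', m x y') := by
    rw [← Finset.sum_neg_distrib]
    exact Finset.sum_congr rfl fun x _ => by rw [negMulLog, ← Finset.sum_mul, neg_mul]
  have htot : negMulLog (∑ x, ∑ y, m x y)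
      = -∑ x, ∑ y, m x y * log (∑ x', ∑ y', m x' y') := by
    simp only [negMulLog, ← Finset.sum_mul, neg_mul]
  rw [hcol, hrow, htot]
  simp only [negMulLog, neg_mul, mul_sub, mul_add, Finset.sum_sub_distrib,
    Finset.sum_add_distrib, Finset.sum_neg_distrib]
  ring

/-- Subadditivity of entropy for a nonnegative matrix and its marginals. -/
lemma sum_negMulLog_marginals_nonneg {S T : Type*} [Fintype S] [Fintype T] (m : S → T → ℝ)
    (hm : ∀ x y, 0 ≤ m x y) :
    0 ≤ ∑ x, negMulLog (∑ y, m x y) + ∑ y, negMulLog (∑ x, m x y)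
        - negMulLog (∑ x, ∑ y, m x y) - ∑ x, ∑ y, negMulLog (m x y) := by
  rw [sum_negMulLog_marginals]
  set t := ∑ x, ∑ y, m x y with ht
  have hr : ∀ x, 0 ≤ ∑ y, m x y := fun x => Finset.sum_nonneg fun y _ => hm x y
  have hc : ∀ y, 0 ≤ ∑ x, m x y := fun y => Finset.sum_nonneg fun x _ => hm x y
  have ht0 : 0 ≤ t := Finset.sum_nonneg fun x _ => hr x
  have hsum : ∑ x, ∑ y, (m x y - (∑ y', m x y') * (∑ x', m x' y) / t) = 0 := by
    have htc : ∑ y, ∑ x, m x y = t := Finset.sum_comm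
    simp only [Finset.sum_sub_distrib, ← Finset.sum_div, ← Finset.mul_sum, htc, ← Finset.sum_mul]
    rw [← ht, mul_self_div_self, sub_self]
  rw [← hsum]
  refine Finset.sum_le_sum fun x _ => Finset.sum_le_sum fun y _ => ?_
  rcases (hm x y).eq_or_lt with h | h
  · have := div_nonneg (mul_nonneg (hr x) (hc y)) ht0
    rw [← h]
    linarith
  · have hrx : 0 < ∑ y', m x y' :=
      h.trans_le (Finset.single_le_sum (fun y' _ => hm x y') (Finset.mem_univ y))
    have hcy : 0 < ∑ x', m x' y :=
      h.trans_le (Finset.single_le_sum (fun x' _ => hm x' y) (Finset.mem_univ x))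
    have htp : 0 < t :=
      hrx.trans_le (Finset.single_le_sum (fun x' _ => hr x') (Finset.mem_univ x))
    have key := log_le_sub_one_of_pos (div_pos (mul_pos hrx hcy) (mul_pos h htp))
    rw [log_div (by positivity) (by positivity), log_mul hrx.ne' hcy.ne',
      log_mul h.ne' htp.ne'] at key
    have key' := mul_le_mul_of_nonneg_left key h.le
    have hdiv : m x y * ((∑ y', m x y') * (∑ x', m x' y) / (m x y * t))
        = (∑ y', m x y') * (∑ x', m x' y) / t := by
      field_simp
    rw [mul_sub _ _ (1 : ℝ), hdiv] at key'
    linarith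

/-- Equality in subadditivity of entropy for a matrix of product form. -/
lemma sum_negMulLog_marginals_eq_zero {S T : Type*} [Fintype S] [Fintype T] (m : S → T → ℝ)
    (hm : ∀ x y, 0 ≤ m x y)
    (hprod : ∀ x y, m x y * ∑ x', ∑ y', m x' y' = (∑ y', m x y') * ∑ x', m x' y) :
    ∑ x, negMulLog (∑ y, m x y) + ∑ y, negMulLog (∑ x, m x y)
        - negMulLog (∑ x, ∑ y, m x y) - ∑ x, ∑ y, negMulLog (m x y) = 0 := by
  rw [sum_negMulLog_marginals]
  refine Finset.sum_eq_zero fun x _ => Finset.sum_eq_zero fun y _ => ?_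
  rcases (hm x y).eq_or_lt with h | h
  · rw [← h, zero_mul]
  · have hrx : 0 < ∑ y', m x y' :=
      h.trans_le (Finset.single_le_sum (fun y' _ => hm x y') (Finset.mem_univ y))
    have hcy : 0 < ∑ x', m x' y :=
      h.trans_le (Finset.single_le_sum (fun x' _ => hm x' y) (Finset.mem_univ x))
    have htp : 0 < ∑ x', ∑ y', m x' y' :=
      hrx.trans_le (Finset.single_le_sum
        (fun x' _ => Finset.sum_nonneg fun y' _ => hm x' y') (Finset.mem_univ x))
    have key := congrArg log (hprod x y)
    rw [log_mul h.ne' htp.ne', log_mul hrx.ne' hcy.ne'] at key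
    rw [key]
    ring

/-- Summing a joint law over its first variable gives the law of the other two. -/
lemma measureReal_eq_sum_left {Ω : Type*} [MeasurableSpace Ω] (μ : Measure Ω)
    [IsFiniteMeasure μ] {S T U : Type*}
    [Fintype S] [MeasurableSpace S] [MeasurableSingletonClass S]
    {X : Ω → S} {Y : Ω → T}
    (hX : Measurable X) (Z : Ω → U) (y : T) (z : U) :
    μ.real {ω | Y ω = y ∧ Z ω = z} = ∑ x, μ.real {ω | X ω = x ∧ Y ω = y ∧ Z ω = z} := by
  rw [measureReal_eq_sum_inter_preimage μ hX]
  refine Finset.sum_congr rfl fun x _ => congrArg _ ?_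
  ext ω
  simp only [Set.mem_inter_iff, Set.mem_ofPred_eq, Set.mem_preimage, Set.mem_singleton_iff]
  tauto

/-- Summing a joint law over its second variable gives the law of the other two. -/
lemma measureReal_eq_sum_middle {Ω : Type*} [MeasurableSpace Ω] (μ : Measure Ω)
    [IsFiniteMeasure μ] {S T U : Type*}
    [Fintype T] [MeasurableSpace T] [MeasurableSingletonClass T]
    {X : Ω → S} {Y : Ω → T}
    (hY : Measurable Y) (Z : Ω → U) (x : S) (z : U) :
    μ.real {ω | X ω = x ∧ Z ω = z} = ∑ y, μ.real {ω | X ω = x ∧ Y ω = y ∧ Z ω = z} := by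
  rw [measureReal_eq_sum_inter_preimage μ hY]
  refine Finset.sum_congr rfl fun y _ => congrArg _ ?_
  ext ω
  simp only [Set.mem_inter_iff, Set.mem_ofPred_eq, Set.mem_preimage, Set.mem_singleton_iff]
  tauto

/-- Summing a joint law over its first two variables gives the law of the third. -/
lemma measureReal_eq_sum_sum {Ω : Type*} [MeasurableSpace Ω] (μ : Measure Ω)
    [IsFiniteMeasure μ] {S T U : Type*}
    [Fintype S] [MeasurableSpace S] [MeasurableSingletonClass S]
    [Fintype T] [MeasurableSpace T] [MeasurableSingletonClass T]
    {X : Ω → S} {Y : Ω → T}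
    (hX : Measurable X) (hY : Measurable Y) (Z : Ω → U) (z : U) :
    μ.real {ω | Z ω = z} = ∑ x, ∑ y, μ.real {ω | X ω = x ∧ Y ω = y ∧ Z ω = z} := by
  rw [measureReal_eq_sum_inter_preimage μ hX]
  refine Finset.sum_congr rfl fun x _ => ?_
  rw [← measureReal_eq_sum_middle μ hY]
  refine congrArg _ ?_
  ext ω
  simp only [Set.mem_inter_iff, Set.mem_ofPred_eq, Set.mem_preimage, Set.mem_singleton_iff]
  tauto

section CondMutualInfo

variable {Ω : Type*} [MeasurableSpace Ω] (μ : Measure Ω) [IsFiniteMeasure μ]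
  {S T U : Type*} [Fintype S] [Fintype T] [Fintype U]
  [MeasurableSpace S] [MeasurableSingletonClass S]
  [MeasurableSpace T] [MeasurableSingletonClass T]
  {X : Ω → S} {Y : Ω → T}

/-- Conditional mutual information as a sum of entropy defects of the slices of the joint law. -/
lemma condMutualInfo_eq_sum (hX : Measurable X) (hY : Measurable Y) (Z : Ω → U)
    (m : U → S → T → ℝ) (hm : ∀ z x y, m z x y = μ.real {ω | X ω = x ∧ Y ω = y ∧ Z ω = z}) :
    condMutualInfo μ X Y Z = ∑ z, (∑ x, negMulLog (∑ y, m z x y)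
      + ∑ y, negMulLog (∑ x, m z x y) - negMulLog (∑ x, ∑ y, m z x y)
      - ∑ x, ∑ y, negMulLog (m z x y)) := by
  have hXZ : entropy μ (fun ω => (X ω, Z ω)) = ∑ z, ∑ x, negMulLog (∑ y, m z x y) := by
    simp only [hm, ← measureReal_eq_sum_middle μ hY, entropy, Fintype.sum_prod_type_right]
    simp only [Set.preimage, Set.mem_singleton_iff, Prod.mk.injEq, Measure.real]
  have hYZ : entropy μ (fun ω => (Y ω, Z ω)) = ∑ z, ∑ y, negMulLog (∑ x, m z x y) := by
    simp only [hm, ← measureReal_eq_sum_left μ hX, entropy, Fintype.sum_prod_type_right]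
    simp only [Set.preimage, Set.mem_singleton_iff, Prod.mk.injEq, Measure.real]
  have hZ : entropy μ Z = ∑ z, negMulLog (∑ x, ∑ y, m z x y) := by
    simp only [hm, ← measureReal_eq_sum_sum μ hX hY, entropy]
    simp only [Set.preimage, Set.mem_singleton_iff, Measure.real]
  have hXYZ : entropy μ (fun ω => ((X ω, Y ω), Z ω))
      = ∑ z, ∑ x, ∑ y, negMulLog (m z x y) := by
    rw [entropy, Fintype.sum_prod_type_right]
    simp only [hm, Fintype.sum_prod_type]
    simp only [Set.preimage, Set.mem_singleton_iff, Prod.mk.injEq, Measure.real, and_assoc]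
  simp only [condMutualInfo, condEntropy, Finset.sum_sub_distrib, Finset.sum_add_distrib,
    ← hXZ, ← hYZ, ← hZ, ← hXYZ]
  ring

/-- Conditional mutual information is nonnegative. -/
lemma condMutualInfo_nonneg (hX : Measurable X) (hY : Measurable Y) (Z : Ω → U) :
    0 ≤ condMutualInfo μ X Y Z := by
  rw [condMutualInfo_eq_sum μ hX hY Z _ fun _ _ _ => rfl]
  exact Finset.sum_nonneg fun z _ =>
    sum_negMulLog_marginals_nonneg _ fun _ _ => measureReal_nonneg

/-- Conditional mutual information vanishes under conditional independence. -/
lemma condMutualInfo_eq_zero (hX : Measurable X) (hY : Measurable Y) (Z : Ω → U)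
    (h : ∀ x y z, μ {ω | X ω = x ∧ Y ω = y ∧ Z ω = z} * μ {ω | Z ω = z}
      = μ {ω | X ω = x ∧ Z ω = z} * μ {ω | Y ω = y ∧ Z ω = z}) :
    condMutualInfo μ X Y Z = 0 := by
  rw [condMutualInfo_eq_sum μ hX hY Z _ fun _ _ _ => rfl]
  refine Finset.sum_eq_zero fun z _ =>
    sum_negMulLog_marginals_eq_zero _ (fun _ _ => measureReal_nonneg) fun x y => ?_
  rw [← measureReal_eq_sum_sum μ hX hY, ← measureReal_eq_sum_middle μ hY,
    ← measureReal_eq_sum_left μ hX]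
  simpa only [Measure.real, ENNReal.toReal_mul] using congrArg ENNReal.toReal (h x y z)

end CondMutualInfo

/-- Information bottleneck Lagrangian bound and optimality condition: if
`Y → A → Z` is a Markov chain and `β ∈ [0, 1]`, then
`I(Z; Y) − β·I(Z; A) ≤ (1−β)·I(A; Y)`; moreover if `0 < β < 1` then equality
holds iff `I(A; Y | Z) = 0` and `I(Z; A | Y) = 0`. -/
theorem information_bottleneck_bound
    {Ω : Type*} [MeasurableSpace Ω] (μ : Measure Ω) [IsProbabilityMeasure μ]
    {𝒴 𝒜 𝒵 : Type*}
    [Fintype 𝒴] [Nonempty 𝒴] [MeasurableSpace 𝒴] [MeasurableSingletonClass 𝒴]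
    [Fintype 𝒜] [Nonempty 𝒜] [MeasurableSpace 𝒜] [MeasurableSingletonClass 𝒜]
    [Fintype 𝒵] [Nonempty 𝒵] [MeasurableSpace 𝒵] [MeasurableSingletonClass 𝒵]
    (Y : Ω → 𝒴) (A : Ω → 𝒜) (Z : Ω → 𝒵)
    (hY : Measurable Y) (hA : Measurable A) (hZ : Measurable Z)
    (hMarkov : ∀ (y : 𝒴) (a : 𝒜) (z : 𝒵),
      μ {ω | Y ω = y ∧ Z ω = z ∧ A ω = a} * μ {ω | A ω = a}
        = μ {ω | Y ω = y ∧ A ω = a} * μ {ω | Z ω = z ∧ A ω = a})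
    (β : ℝ) (hβ0 : 0 ≤ β) (hβ1 : β ≤ 1) :
    mutualInfo μ Z Y - β * mutualInfo μ Z A ≤ (1 - β) * mutualInfo μ A Y ∧
      (0 < β → β < 1 →
        (mutualInfo μ Z Y - β * mutualInfo μ Z A = (1 - β) * mutualInfo μ A Y ↔
          condMutualInfo μ A Y Z = 0 ∧ condMutualInfo μ Z A Y = 0)) := by
  have hYZ_A := condMutualInfo_eq_zero μ hY hZ A fun y z a => hMarkov y a z
  have hAY_Z := condMutualInfo_nonneg μ hA hY Z
  have hZA_Y := condMutualInfo_nonneg μ hZ hA Y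
  have hAY := entropy_equiv_comp μ (Equiv.prodComm 𝒴 𝒜) fun ω => (Y ω, A ω)
  have hAZ := entropy_equiv_comp μ (Equiv.prodComm 𝒵 𝒜) fun ω => (Z ω, A ω)
  have hYZ := entropy_equiv_comp μ (Equiv.prodComm 𝒵 𝒴) fun ω => (Z ω, Y ω)
  have hAYZ := entropy_equiv_comp μ
    ((Equiv.prodComm (𝒴 × 𝒵) 𝒜).trans (Equiv.prodAssoc 𝒜 𝒴 𝒵).symm)
    fun ω => ((Y ω, Z ω), A ω)
  have hZAY := entropy_equiv_comp μ
    ((Equiv.prodAssoc 𝒴 𝒵 𝒜).trans ((Equiv.prodComm 𝒴 (𝒵 × 𝒜))))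
    fun ω => ((Y ω, Z ω), A ω)
  simp only [Equiv.prodComm_apply, Equiv.trans_apply, Equiv.prodAssoc_apply,
    Equiv.prodAssoc_symm_apply, Prod.swap_prod_mk] at hAY hAZ hYZ hAYZ hZAY
  have hgap : (1 - β) * mutualInfo μ A Y - (mutualInfo μ Z Y - β * mutualInfo μ Z A)
      = (1 - β) * condMutualInfo μ A Y Z + β * condMutualInfo μ Z A Y := by
    simp only [condMutualInfo, condEntropy, mutualInfo, hAY, hAZ, hYZ, hAYZ, hZAY] at hYZ_A ⊢
    linear_combination -hYZ_A
  have h1 : 0 ≤ (1 - β) * condMutualInfo μ A Y Z := mul_nonneg (sub_nonneg.2 hβ1) hAY_Z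
  have h2 : 0 ≤ β * condMutualInfo μ Z A Y := mul_nonneg hβ0 hZA_Y
  refine ⟨by linarith, fun hpos hlt => ⟨fun heq => ?_, fun ⟨hc1, hc2⟩ => ?_⟩⟩
  · have e1 : (1 - β) * condMutualInfo μ A Y Z = 0 := by linarith
    have e2 : β * condMutualInfo μ Z A Y = 0 := by linarith
    exact ⟨(mul_eq_zero.1 e1).resolve_left (sub_pos.2 hlt).ne',
      (mul_eq_zero.1 e2).resolve_left hpos.ne'⟩
  · rw [hc1, hc2] at hgap
    linarith
end
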